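/- (Korn-Sobolev-type interpolation inequality for the shell) There exists C(L) depending only on L such that for all sufficiently small h and all φ ∈ V_h¹ ∪ V_h², ‖∇φ‖² ≤ C(L)‖e(φ)‖(‖φ_r‖/h + ‖e(φ)‖), where norms are L²(C_h). -/

import Mathlib

open Real MeasureTheory

noncomputable section

/-- r-partial derivative of a function on (r,θ,z)-space. -/
def dr (f : ℝ × ℝ × ℝ → ℝ) (q : ℝ × ℝ × ℝ) : ℝ := fderiv ℝ f q (1, 0, 0)

/-- θ-partial derivative. -/
def dth (f : ℝ × ℝ × ℝ → ℝ) (q : ℝ × ℝ × ℝ) : ℝ := fderiv ℝ f q (0, 1, 0)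

/-- z-partial derivative. -/
def dz (f : ℝ × ℝ × ℝ → ℝ) (q : ℝ × ℝ × ℝ) : ℝ := fderiv ℝ f q (0, 0, 1)

/-- The cylindrical shell C_h (in cylindrical coordinates, with θ ∈ [0,2π]). -/
def shell (h L : ℝ) : Set (ℝ × ℝ × ℝ) :=
  Set.Icc (1 - h/2) (1 + h/2) ×ˢ Set.Icc 0 (2*π) ×ˢ Set.Icc 0 L

/-- 2π-periodicity in θ. -/
def Periodic3 (f : ℝ × ℝ × ℝ → ℝ) : Prop :=
  ∀ q : ℝ × ℝ × ℝ, f (q.1, q.2.1 + 2*π, q.2.2) = f q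

/-- Squared Frobenius norm of the gradient in cylindrical coordinates. -/
def gradSq (fr fθ fz : ℝ × ℝ × ℝ → ℝ) (q : ℝ × ℝ × ℝ) : ℝ :=
  (dr fr q)^2 + ((dth fr q - fθ q)/q.1)^2 + (dz fr q)^2 +
  (dr fθ q)^2 + ((dth fθ q + fr q)/q.1)^2 + (dz fθ q)^2 +
  (dr fz q)^2 + (dth fz q / q.1)^2 + (dz fz q)^2

/-- Squared Frobenius norm of the symmetrized gradient in cylindrical coordinates. -/
def eSq (fr fθ fz : ℝ × ℝ × ℝ → ℝ) (q : ℝ × ℝ × ℝ) : ℝ :=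
  (dr fr q)^2 + ((dth fθ q + fr q)/q.1)^2 + (dz fz q)^2 +
  2*((dr fθ q + (dth fr q - fθ q)/q.1)/2)^2 +
  2*((dz fr q + dr fz q)/2)^2 +
  2*((dz fθ q + dth fz q / q.1)/2)^2

/-- Squared Frobenius norm of the modified gradient matrix A (1/r factors removed). -/
def ASq (fr fθ fz : ℝ × ℝ × ℝ → ℝ) (q : ℝ × ℝ × ℝ) : ℝ :=
  (dr fr q)^2 + (dth fr q - fθ q)^2 + (dz fr q)^2 +
  (dr fθ q)^2 + (dth fθ q + fr q)^2 + (dz fθ q)^2 +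
  (dr fz q)^2 + (dth fz q)^2 + (dz fz q)^2

/-- Squared Frobenius norm of A_sym = (A + Aᵀ)/2. -/
def AsymSq (fr fθ fz : ℝ × ℝ × ℝ → ℝ) (q : ℝ × ℝ × ℝ) : ℝ :=
  (dr fr q)^2 + (dth fθ q + fr q)^2 + (dz fz q)^2 +
  2*((dr fθ q + dth fr q - fθ q)/2)^2 +
  2*((dz fr q + dr fz q)/2)^2 +
  2*((dz fθ q + dth fz q)/2)^2

/-- Boundary conditions of the space V_h¹: φ = 0 at z = 0, φ_r = φ_θ = 0 at z = L. -/
def BC1 (L : ℝ) (fr fθ fz : ℝ × ℝ × ℝ → ℝ) : Prop :=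
  ∀ r θ : ℝ, fr (r, θ, 0) = 0 ∧ fθ (r, θ, 0) = 0 ∧ fz (r, θ, 0) = 0 ∧
    fr (r, θ, L) = 0 ∧ fθ (r, θ, L) = 0

/-- Boundary conditions of the space V_h²: φ_θ = φ_z = 0 at z = 0 and z = L. -/
def BC2 (L : ℝ) (fr fθ fz : ℝ × ℝ × ℝ → ℝ) : Prop :=
  ∀ r θ : ℝ, fθ (r, θ, 0) = 0 ∧ fz (r, θ, 0) = 0 ∧
    fθ (r, θ, L) = 0 ∧ fz (r, θ, L) = 0

/-- Iterated integral over the rectangle `[0, a] × [0, b]`. -/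
def rectInt (a b : ℝ) (f : ℝ × ℝ → ℝ) : ℝ := ∫ x in (0:ℝ)..a, ∫ y in (0:ℝ)..b, f (x, y)

theorem rectInt_add (a b : ℝ) {f g : ℝ × ℝ → ℝ} (hf : Continuous f) (hg : Continuous g) :
    rectInt a b (fun p => f p + g p) = rectInt a b f + rectInt a b g := by
  unfold rectInt
  rw [← intervalIntegral.integral_add
    (Continuous.intervalIntegrable (by fun_prop) _ _)
    (Continuous.intervalIntegrable (by fun_prop) _ _)]
  congr 1
  ext x
  exact intervalIntegral.integral_add
    (Continuous.intervalIntegrable (by fun_prop) _ _)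
    (Continuous.intervalIntegrable (by fun_prop) _ _)

theorem rectInt_const_mul (a b c : ℝ) (f : ℝ × ℝ → ℝ) :
    rectInt a b (fun p => c * f p) = c * rectInt a b f := by
  simp [rectInt, intervalIntegral.integral_const_mul]

theorem rectInt_sub (a b : ℝ) {f g : ℝ × ℝ → ℝ} (hf : Continuous f) (hg : Continuous g) :
    rectInt a b (fun p => f p - g p) = rectInt a b f - rectInt a b g := by
  have h := rectInt_add a b hf (show Continuous fun p => (-1) * g p by fun_prop)
  rw [rectInt_const_mul] at h
  rw [show (fun p => f p - g p) = fun p => f p + (-1) * g p by ext p; ring, h]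
  ring

theorem rectInt_mono {a b : ℝ} (ha : 0 ≤ a) (hb : 0 ≤ b) {f g : ℝ × ℝ → ℝ}
    (hf : Continuous f) (hg : Continuous g)
    (hfg : ∀ x ∈ Set.Icc 0 a, ∀ y ∈ Set.Icc 0 b, f (x, y) ≤ g (x, y)) :
    rectInt a b f ≤ rectInt a b g :=
  intervalIntegral.integral_mono_on ha
    (Continuous.intervalIntegrable (by fun_prop) _ _)
    (Continuous.intervalIntegrable (by fun_prop) _ _) fun x hx =>
    intervalIntegral.integral_mono_on hb
      (Continuous.intervalIntegrable (by fun_prop) _ _)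
      (Continuous.intervalIntegrable (by fun_prop) _ _) fun y hy => hfg x hx y hy

theorem rectInt_nonneg {a b : ℝ} (ha : 0 ≤ a) (hb : 0 ≤ b) {f : ℝ × ℝ → ℝ}
    (h : ∀ p, 0 ≤ f p) : 0 ≤ rectInt a b f :=
  intervalIntegral.integral_nonneg ha fun _ _ =>
    intervalIntegral.integral_nonneg hb fun _ _ => h _

theorem rectInt_le_of_le {a a' b : ℝ} (ha : 0 ≤ a) (haa' : a ≤ a') (hb : 0 ≤ b)
    {f : ℝ × ℝ → ℝ} (hf : Continuous f) (h : ∀ p, 0 ≤ f p) :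
    rectInt a b f ≤ rectInt a' b f :=
  intervalIntegral.integral_mono_interval le_rfl ha haa'
    (Filter.Eventually.of_forall fun _ => intervalIntegral.integral_nonneg hb fun _ _ => h _)
    (Continuous.intervalIntegrable (by fun_prop) _ _)

theorem rectInt_comp_two_mul (a b : ℝ) (f : ℝ × ℝ → ℝ) :
    rectInt (a / 2) b (fun p => f (2 * p.1, p.2)) = rectInt a b f / 2 := by
  have h := intervalIntegral.integral_comp_mul_left (a := 0) (b := a / 2)
    (fun x => ∫ y in (0:ℝ)..b, f (x, y)) (c := 2) two_ne_zero
  simp only [rectInt]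
  rw [h, mul_zero, mul_div_cancel₀ a two_ne_zero, smul_eq_mul]
  ring

theorem rectInt_comp_sub (a b : ℝ) (f : ℝ × ℝ → ℝ) :
    rectInt a b (fun p => f (a - p.1, p.2)) = rectInt a b f := by
  have h := intervalIntegral.integral_comp_sub_left (a := 0) (b := a)
    (fun x => ∫ y in (0:ℝ)..b, f (x, y)) a
  simpa [rectInt] using h

theorem intervalIntegral_swap_of_continuous (a b c d : ℝ) {f : ℝ × ℝ → ℝ} (hf : Continuous f) :
    ∫ x in a..b, ∫ y in c..d, f (x, y) = ∫ y in c..d, ∫ x in a..b, f (x, y) := by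
  refine MeasureTheory.intervalIntegral_intervalIntegral_swap (F := fun x y => f (x, y)) ?_
  exact (hf.continuousOn.integrableOn_compact
    (isCompact_uIcc.prod isCompact_uIcc)).mono_set
      (Set.prod_mono Set.uIoc_subset_uIcc Set.uIoc_subset_uIcc)

/-- Divergence identity on a rectangle for the field `(η U G, -η U V)`, `η` affine in the first
variable, when the flux through the sides `y = 0` and `y = b` cancels. -/
theorem rectInt_divergence (a b c d : ℝ) {U Ux Uy G Gx V Vy : ℝ × ℝ → ℝ}
    (hU : Continuous U) (hUx : Continuous Ux) (hUy : Continuous Uy) (hG : Continuous G)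
    (hGx : Continuous Gx) (hV : Continuous V) (hVy : Continuous Vy)
    (dUx : ∀ x y, HasDerivAt (fun t => U (t, y)) (Ux (x, y)) x)
    (dUy : ∀ x y, HasDerivAt (fun t => U (x, t)) (Uy (x, y)) y)
    (dGx : ∀ x y, HasDerivAt (fun t => G (t, y)) (Gx (x, y)) x)
    (dVy : ∀ x y, HasDerivAt (fun t => V (x, t)) (Vy (x, y)) y)
    (hbc : ∀ x, U (x, b) * V (x, b) = U (x, 0) * V (x, 0)) :
    rectInt a b (fun p => c * (U p * G p) +
      (d + c * p.1) * (Ux p * G p + U p * (Gx p - Vy p) - Uy p * V p)) =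
    ∫ y in (0:ℝ)..b, ((d + c * a) * (U (a, y) * G (a, y)) - d * (U (0, y) * G (0, y))) := by
  have h1 : rectInt a b (fun p => c * (U p * G p) +
        (d + c * p.1) * (Ux p * G p + U p * Gx p)) =
      ∫ y in (0:ℝ)..b, ((d + c * a) * (U (a, y) * G (a, y)) - d * (U (0, y) * G (0, y))) := by
    refine (intervalIntegral_swap_of_continuous 0 a 0 b (f := fun p => c * (U p * G p) +
        (d + c * p.1) * (Ux p * G p + U p * Gx p)) (by fun_prop)).trans ?_
    congr 1
    ext y
    rw [intervalIntegral.integral_eq_sub_of_hasDerivAt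
      (f := fun x => (d + c * x) * (U (x, y) * G (x, y))) _
      (Continuous.intervalIntegrable (by fun_prop) _ _)]
    · simp
    · intro x _
      have hη : HasDerivAt (fun x : ℝ => d + c * x) c x := by
        simpa using ((hasDerivAt_id x).const_mul c).const_add d
      exact hη.mul ((dUx x y).mul (dGx x y))
  have h2 : rectInt a b (fun p => (d + c * p.1) * (Uy p * V p + U p * Vy p)) = 0 := by
    unfold rectInt
    refine (intervalIntegral.integral_congr (g := fun _ => 0) fun x _ => ?_).trans (by simp)
    beta_reduce
    rw [intervalIntegral.integral_eq_sub_of_hasDerivAt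
      (f := fun y => (d + c * x) * (U (x, y) * V (x, y))) _
      (Continuous.intervalIntegrable (by fun_prop) _ _)]
    · rw [hbc x, sub_self]
    · intro y _
      exact ((dUy x y).mul (dVy x y)).const_mul _
  rw [← h1]
  refine Eq.trans ?_ (sub_zero _)
  rw [← h2, ← rectInt_sub a b (by fun_prop) (by fun_prop)]
  congr 1
  ext p
  ring

/-- Functions `u`, `v`, `g` on the `(x, y)`-plane together with partial derivatives, where `v` plays
the role of `∂ₓ w` and `g` that of `∂_y w + κ u` for a second displacement component `w`; the flux
`u v` takes the same values on `y = 0` and `y = b`, even across different `x`. -/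
structure PlanePair (b κ : ℝ) (u ux uy g gx v vy : ℝ × ℝ → ℝ) : Prop where
  cu : Continuous u
  cux : Continuous ux
  cuy : Continuous uy
  cg : Continuous g
  cgx : Continuous gx
  cv : Continuous v
  cvy : Continuous vy
  dux : ∀ x y, HasDerivAt (fun t => u (t, y)) (ux (x, y)) x
  duy : ∀ x y, HasDerivAt (fun t => u (x, t)) (uy (x, y)) y
  dgx : ∀ x y, HasDerivAt (fun t => g (t, y)) (gx (x, y)) x
  dvy : ∀ x y, HasDerivAt (fun t => v (x, t)) (vy (x, y)) y
  compat : ∀ p, gx p - vy p = κ * ux p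
  flux : ∀ x x', u (x, b) * v (x', b) = u (x, 0) * v (x', 0)

/-- The density controlling the tangential derivative in the planar Korn-type estimate. -/
def planeDensity (l h : ℝ) (u ux uy g v : ℝ × ℝ → ℝ) (p : ℝ × ℝ) : ℝ :=
  (uy p + v p)^2 + ux p^2 + g p^2 + l * u p^2 + (ux p^2 + g p^2) / (l * h^2)

theorem planeDensity_nonneg {l h : ℝ} (hl : 0 < l) (u ux uy g v : ℝ × ℝ → ℝ) (p : ℝ × ℝ) :
    0 ≤ planeDensity l h u ux uy g v p := by
  unfold planeDensity
  positivity

theorem PlanePair.continuous_planeDensity {b κ : ℝ} {u ux uy g gx v vy : ℝ × ℝ → ℝ}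
    (H : PlanePair b κ u ux uy g gx v vy) (l h : ℝ) :
    Continuous (planeDensity l h u ux uy g v) := by
  have := H.cu; have := H.cux; have := H.cuy; have := H.cg; have := H.cv
  unfold planeDensity
  simp only [div_eq_mul_inv]
  fun_prop

/-- Reflection across the midline `x = h / 2`. -/
theorem PlanePair.reflect {b κ : ℝ} {u ux uy g gx v vy : ℝ × ℝ → ℝ}
    (H : PlanePair b κ u ux uy g gx v vy) (h : ℝ) :
    PlanePair b (-κ) (fun p => -u (h - p.1, p.2)) (fun p => ux (h - p.1, p.2))
      (fun p => -uy (h - p.1, p.2)) (fun p => g (h - p.1, p.2)) (fun p => -gx (h - p.1, p.2))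
      (fun p => -v (h - p.1, p.2)) (fun p => -vy (h - p.1, p.2)) := by
  obtain ⟨cu, cux, cuy, cg, cgx, cv, cvy, dux, duy, dgx, dvy, hc, hf⟩ := H
  have hr : ∀ x : ℝ, HasDerivAt (fun t : ℝ => h - t) (-1) x := fun x => by
    simpa using (hasDerivAt_id x).const_sub h
  refine ⟨by fun_prop, by fun_prop, by fun_prop, by fun_prop, by fun_prop, by fun_prop,
    by fun_prop, fun x y => ?_, fun x y => (duy (h - x) y).fun_neg, fun x y => ?_,
    fun x y => (dvy (h - x) y).fun_neg,
    fun p => ?_, fun x x' => ?_⟩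
  · have := ((dux (h - x) y).scomp x (hr x)).fun_neg
    simpa [Function.comp_def] using this
  · have := (dgx (h - x) y).scomp x (hr x)
    simpa [Function.comp_def] using this
  · linear_combination -(hc (h - p.1, p.2))
  · linear_combination hf (h - x) (h - x')

/-- Fluxes through `x = 0` of the pair and of its Nitsche-type extension agree. -/
theorem PlanePair.rectInt_eq_extension {b κ h : ℝ} {u ux uy g gx v vy : ℝ × ℝ → ℝ} (hh : 0 < h)
    (H : PlanePair b κ u ux uy g gx v vy) :
    rectInt h b (fun p => (-1 / h) * (u p * g p) +
      (1 + (-1 / h) * p.1) * (ux p * g p + u p * (gx p - vy p) - uy p * v p)) =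
    rectInt (h / 2) b (fun p =>
      (-2 / h) * ((-3 * u p + 4 * u (2 * p.1, p.2)) * (3 * g p - 2 * g (2 * p.1, p.2))) +
      (1 + (-2 / h) * p.1) *
        ((-3 * ux p + 8 * ux (2 * p.1, p.2)) * (3 * g p - 2 * g (2 * p.1, p.2)) +
         (-3 * u p + 4 * u (2 * p.1, p.2)) *
          ((3 * gx p - 4 * gx (2 * p.1, p.2)) - (3 * vy p - 4 * vy (2 * p.1, p.2))) -
         (-3 * uy p + 4 * uy (2 * p.1, p.2)) * (3 * v p - 4 * v (2 * p.1, p.2)))) := by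
  obtain ⟨cu, cux, cuy, cg, cgx, cv, cvy, dux, duy, dgx, dvy, hc, hf⟩ := H
  have hr : ∀ x : ℝ, HasDerivAt (fun t : ℝ => 2 * t) 2 x := fun x => by
    simpa using (hasDerivAt_id x).const_mul 2
  rw [rectInt_divergence h b (-1 / h) 1 cu cux cuy cg cgx cv cvy dux duy dgx dvy
    (fun x => hf x x)]
  rw [rectInt_divergence (h / 2) b (-2 / h) 1
    (U := fun p => -3 * u p + 4 * u (2 * p.1, p.2))
    (Ux := fun p => -3 * ux p + 8 * ux (2 * p.1, p.2))
    (Uy := fun p => -3 * uy p + 4 * uy (2 * p.1, p.2))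
    (G := fun p => 3 * g p - 2 * g (2 * p.1, p.2))
    (Gx := fun p => 3 * gx p - 4 * gx (2 * p.1, p.2))
    (V := fun p => 3 * v p - 4 * v (2 * p.1, p.2))
    (Vy := fun p => 3 * vy p - 4 * vy (2 * p.1, p.2))
    (by fun_prop) (by fun_prop) (by fun_prop) (by fun_prop) (by fun_prop) (by fun_prop)
    (by fun_prop)]
  · congr 1
    ext y
    simp only [mul_zero]
    field_simp
    ring
  · intro x y
    have := ((dux x y).const_mul (-3)).add (((dux (2 * x) y).scomp x (hr x)).const_mul 4)
    refine this.congr_deriv ?_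
    simp only [smul_eq_mul]
    ring
  · intro x y
    exact ((duy x y).const_mul (-3)).add ((duy (2 * x) y).const_mul 4)
  · intro x y
    have := ((dgx x y).const_mul 3).sub (((dgx (2 * x) y).scomp x (hr x)).const_mul 2)
    refine this.congr_deriv ?_
    simp only [smul_eq_mul]
    ring
  · intro x y
    exact ((dvy x y).const_mul 3).sub ((dvy (2 * x) y).const_mul 4)
  · intro x
    simp only
    linear_combination -9 * hf x x + 12 * hf x (2 * x) + 12 * hf (2 * x) x
      - 16 * hf (2 * x) (2 * x)

theorem abs_mul_div_le {l h : ℝ} (hl : 0 < l) (hh : 0 < h) (x y : ℝ) :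
    |x * y| / h ≤ (l * x^2 + y^2 / (l * h^2)) / 2 := by
  have e : l * x^2 + y^2 / (l * h^2) - 2 * (|x * y| / h) = (l * |x| - |y| / h)^2 / l := by
    rw [abs_mul, ← sq_abs x, ← sq_abs y]
    field_simp
    ring
  have : 0 ≤ (l * |x| - |y| / h)^2 / l := by positivity
  linarith

theorem mul_mul_le {l h κ : ℝ} (hl : 0 < l) (hh : 0 < h) (hh1 : h ≤ 1) (hκ : |κ| ≤ 1)
    (x y : ℝ) : |x * (κ * y)| ≤ (l * x^2 + y^2 / (l * h^2)) / 2 := by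
  refine le_trans ?_ (abs_mul_div_le hl hh x y)
  rw [le_div_iff₀ hh, show x * (κ * y) = κ * (x * y) by ring, abs_mul]
  have h1 : |κ| * |x * y| ≤ 1 * |x * y| := by gcongr
  have h2 : |κ| * |x * y| * h ≤ |κ| * |x * y| * 1 := by gcongr
  linarith

theorem weight_mul_le {η x B : ℝ} (hη0 : 0 ≤ η) (hη1 : η ≤ 1) (hx : |x| ≤ B) :
    |η * x| ≤ B := by
  rw [abs_mul, abs_of_nonneg hη0]
  calc η * |x| ≤ 1 * |x| := by gcongr
    _ ≤ B := by linarith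

theorem abs_mul_le_half (x y : ℝ) : |x * y| ≤ (x^2 + y^2) / 2 := by
  rw [abs_le]
  constructor <;> nlinarith [sq_nonneg (x - y), sq_nonneg (x + y)]

theorem interior_integrand_lower {l h κ η u ux uy g gx v vy : ℝ} (hl : 0 < l) (hh : 0 < h)
    (hh1 : h ≤ 1) (hκ : |κ| ≤ 1) (hη0 : 0 ≤ η) (hη1 : η ≤ 1) (hc : gx - vy = κ * ux) :
    η * uy^2 / 2 - 5 * ((uy + v)^2 + ux^2 + g^2 + l * u^2 + (ux^2 + g^2) / (l * h^2)) ≤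
      (-1 / h) * (u * g) + η * (ux * g + u * (gx - vy) - uy * v) := by
  have h1 := abs_mul_div_le hl hh u g
  have h1' : (-1 / h) * (u * g) = -((u * g) / h) := by ring
  have h1'' : (u * g) / h ≤ |u * g| / h := by gcongr; exact le_abs_self _
  have h2 := neg_le_of_abs_le (weight_mul_le hη0 hη1 (mul_mul_le hl hh hh1 hκ u ux))
  have h3 := neg_le_of_abs_le (weight_mul_le hη0 hη1 (abs_mul_le_half ux g))
  have h4 : 0 ≤ η * v^2 := by positivity
  have h5 : η * (uy + v)^2 ≤ 1 * (uy + v)^2 := by gcongr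
  have e : η * (ux * g + u * (gx - vy) - uy * v) = η * (ux * g) + η * (u * (κ * ux)) +
      η * uy^2 / 2 + η * v^2 / 2 - η * (uy + v)^2 / 2 := by
    rw [hc]
    ring
  have h6 : 0 ≤ ux^2 / (l * h^2) := by positivity
  have h7 : 0 ≤ g^2 / (l * h^2) := by positivity
  have h8 : 0 ≤ l * u^2 := by positivity
  rw [e, h1', add_div]
  linarith [sq_nonneg ux, sq_nonneg g, sq_nonneg (uy + v)]

theorem extension_integrand_upper {l h κ η u ux uy g gx v vy u' ux' uy' g' gx' v' vy' : ℝ}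
    (hl : 0 < l) (hh : 0 < h)
    (hh1 : h ≤ 1) (hκ : |κ| ≤ 1) (hη0 : 0 ≤ η) (hη1 : η ≤ 1) (hc : gx - vy = κ * ux)
    (hc' : gx' - vy' = κ * ux') :
    (-2 / h) * ((-3 * u + 4 * u') * (3 * g - 2 * g')) +
      η * ((-3 * ux + 8 * ux') * (3 * g - 2 * g') +
         (-3 * u + 4 * u') * ((3 * gx - 4 * gx') - (3 * vy - 4 * vy')) -
         (-3 * uy + 4 * uy') * (3 * v - 4 * v')) ≤
    100 * ((uy + v)^2 + ux^2 + g^2 + l * u^2 + (ux^2 + g^2) / (l * h^2)) +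
    100 * ((uy' + v')^2 + ux'^2 + g'^2 + l * u'^2 + (ux'^2 + g'^2) / (l * h^2)) := by
  have sq1 : ∀ a b c d : ℝ, (a * c + b * d)^2 ≤ 2 * a^2 * c^2 + 2 * b^2 * d^2 := fun a b c d => by
    linarith [sq_nonneg (a * c - b * d), add_sq (a * c) (b * d), sub_sq (a * c) (b * d),
      mul_pow a c 2, mul_pow b d 2]
  have hm : 0 < l * h^2 := by positivity
  have h1 := abs_mul_div_le hl hh (-3 * u + 4 * u') (3 * g - 2 * g')
  have h1' : (-2 / h) * ((-3 * u + 4 * u') * (3 * g - 2 * g')) =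
    -(2 * ((-3 * u + 4 * u') * (3 * g - 2 * g') / h)) := by ring
  have h1'' : -|(-3 * u + 4 * u') * (3 * g - 2 * g')| / h ≤
      (-3 * u + 4 * u') * (3 * g - 2 * g') / h := by gcongr; exact neg_abs_le _
  have h2 := (le_abs_self _).trans
    (weight_mul_le hη0 hη1 (mul_mul_le hl hh hh1 hκ (-3 * u + 4 * u') (3 * ux - 4 * ux')))
  have h3 := (le_abs_self _).trans
    (weight_mul_le hη0 hη1 (abs_mul_le_half (-3 * ux + 8 * ux') (3 * g - 2 * g')))
  have h4 : η * (-3 * (uy + v) + 4 * (uy' + v'))^2 ≤ 1 * (-3 * (uy + v) + 4 * (uy' + v'))^2 := by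
    gcongr
  have h5 : 0 ≤ η * (2 * (-3 * uy + 4 * uy') - (-3 * (uy + v) + 4 * (uy' + v')))^2 := by
    positivity
  have e : η * ((-3 * ux + 8 * ux') * (3 * g - 2 * g') +
         (-3 * u + 4 * u') * ((3 * gx - 4 * gx') - (3 * vy - 4 * vy')) -
         (-3 * uy + 4 * uy') * (3 * v - 4 * v')) =
      η * ((-3 * ux + 8 * ux') * (3 * g - 2 * g')) +
      η * ((-3 * u + 4 * u') * (κ * (3 * ux - 4 * ux'))) +
      η * (-3 * (uy + v) + 4 * (uy' + v'))^2 / 4 -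
      η * (2 * (-3 * uy + 4 * uy') - (-3 * (uy + v) + 4 * (uy' + v')))^2 / 4 := by
    linear_combination 3 * η * (-3 * u + 4 * u') * hc - 4 * η * (-3 * u + 4 * u') * hc'
  have q1 := sq1 (-3) 4 u u'
  have q2 := sq1 3 (-2) g g'
  have q3 := sq1 (-3) 8 ux ux'
  have q4 := sq1 3 (-4) ux ux'
  have q5 := sq1 (-3) 4 (uy + v) (uy' + v')
  have q1' := mul_le_mul_of_nonneg_left q1 hl.le
  have q2' := div_le_div_of_nonneg_right q2 hm.le
  have q4' := div_le_div_of_nonneg_right q4 hm.le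
  rw [neg_mul 2 g', ← sub_eq_add_neg] at q2 q2'
  rw [neg_mul 4 ux', ← sub_eq_add_neg] at q4 q4'
  have p1 : 0 ≤ ux^2 / (l * h^2) := by positivity
  have p2 : 0 ≤ g^2 / (l * h^2) := by positivity
  have p3 : 0 ≤ ux'^2 / (l * h^2) := by positivity
  have p4 : 0 ≤ g'^2 / (l * h^2) := by positivity
  have p5 : 0 ≤ l * u^2 := by positivity
  have p6 : 0 ≤ l * u'^2 := by positivity
  rw [add_div, mul_div_assoc, mul_div_assoc] at q2' q4'
  rw [e, h1', add_div (ux^2), add_div (ux'^2)]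
  rw [neg_div] at h1''
  linarith [sq_nonneg ux, sq_nonneg g, sq_nonneg (uy + v), sq_nonneg ux', sq_nonneg g',
    sq_nonneg (uy' + v')]

theorem PlanePair.weighted_bound {b κ h l : ℝ} {u ux uy g gx v vy : ℝ × ℝ → ℝ} (hb : 0 ≤ b)
    (hh : 0 < h) (hh1 : h ≤ 1) (hl : 0 < l) (hκ : |κ| ≤ 1)
    (H : PlanePair b κ u ux uy g gx v vy) :
    rectInt h b (fun p => (1 + (-1 / h) * p.1) * uy p^2) ≤
      400 * rectInt h b (planeDensity l h u ux uy g v) := by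
  have hP := H.continuous_planeDensity l h
  have hP0 := planeDensity_nonneg (h := h) hl u ux uy g v
  have cP2 : Continuous fun p : ℝ × ℝ => planeDensity l h u ux uy g v (2 * p.1, p.2) := by fun_prop
  have key := H.rectInt_eq_extension hh
  obtain ⟨cu, cux, cuy, cg, cgx, cv, cvy, -, -, -, -, hc, -⟩ := H
  have h1 := rectInt_mono (a := h) (b := b) hh.le hb
    (f := fun p => (1 / 2) * ((1 + (-1 / h) * p.1) * uy p^2) - 5 * planeDensity l h u ux uy g v p)
    (g := fun p => (-1 / h) * (u p * g p) +
      (1 + (-1 / h) * p.1) * (ux p * g p + u p * (gx p - vy p) - uy p * v p))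
    (by fun_prop) (by fun_prop) (by
      intro x hx y hy
      have hη : 1 + (-1 / h) * x = (h - x) / h := by field_simp; ring
      have := interior_integrand_lower (l := l) (h := h) (η := 1 + (-1 / h) * x) (κ := κ)
        (u := u (x, y)) (ux := ux (x, y)) (uy := uy (x, y)) (g := g (x, y)) (gx := gx (x, y))
        (v := v (x, y)) (vy := vy (x, y)) hl hh hh1 hκ
        (by rw [hη]; exact div_nonneg (by linarith [hx.2]) hh.le)
        (by rw [hη, div_le_one hh]; linarith [hx.1]) (hc _)
      unfold planeDensity
      linarith)
  have h2 := rectInt_mono (a := h / 2) (b := b) (by positivity) hb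
    (g := fun p => 100 * planeDensity l h u ux uy g v p +
      100 * planeDensity l h u ux uy g v (2 * p.1, p.2))
    (f := fun p =>
      (-2 / h) * ((-3 * u p + 4 * u (2 * p.1, p.2)) * (3 * g p - 2 * g (2 * p.1, p.2))) +
      (1 + (-2 / h) * p.1) *
        ((-3 * ux p + 8 * ux (2 * p.1, p.2)) * (3 * g p - 2 * g (2 * p.1, p.2)) +
         (-3 * u p + 4 * u (2 * p.1, p.2)) *
          ((3 * gx p - 4 * gx (2 * p.1, p.2)) - (3 * vy p - 4 * vy (2 * p.1, p.2))) -
         (-3 * uy p + 4 * uy (2 * p.1, p.2)) * (3 * v p - 4 * v (2 * p.1, p.2))))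
    (by fun_prop) (by fun_prop) (by
      intro x hx y hy
      have hη : 1 + (-2 / h) * x = (h - 2 * x) / h := by field_simp; ring
      exact extension_integrand_upper hl hh hh1 hκ
        (by rw [hη]; exact div_nonneg (by linarith [hx.2]) hh.le)
        (by rw [hη, div_le_one hh]; linarith [hx.1]) (hc _) (hc _))
  rw [rectInt_sub _ _ (by fun_prop) (by fun_prop), rectInt_const_mul, rectInt_const_mul] at h1
  rw [← key, rectInt_add (h / 2) _ (by fun_prop) (by fun_prop), rectInt_const_mul, rectInt_const_mul,
    rectInt_comp_two_mul] at h2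
  have h3 := rectInt_le_of_le (a := h / 2) (a' := h) (by positivity) (by linarith) hb hP hP0
  have h4 := rectInt_nonneg hh.le hb hP0
  linarith

/-- Korn-type interpolation estimate in the plane for the tangential derivative. -/
theorem PlanePair.bound {b κ h l : ℝ} {u ux uy g gx v vy : ℝ × ℝ → ℝ} (hb : 0 ≤ b)
    (hh : 0 < h) (hh1 : h ≤ 1) (hl : 0 < l) (hκ : |κ| ≤ 1)
    (H : PlanePair b κ u ux uy g gx v vy) :
    rectInt h b (fun p => uy p^2) ≤ 800 * rectInt h b (planeDensity l h u ux uy g v) := by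
  have h1 := H.weighted_bound hb hh hh1 hl hκ
  have h2 := (H.reflect h).weighted_bound hb hh hh1 hl (by rwa [abs_neg])
  have e1 := rectInt_comp_sub h b fun p => (1 + (-1 / h) * (h - p.1)) * uy p^2
  have e2 := rectInt_comp_sub h b (planeDensity l h u ux uy g v)
  have e3 : (fun p : ℝ × ℝ => planeDensity l h u ux uy g v (h - p.1, p.2)) =
      planeDensity l h (fun p => -u (h - p.1, p.2)) (fun p => ux (h - p.1, p.2))
      (fun p => -uy (h - p.1, p.2)) (fun p => g (h - p.1, p.2)) (fun p => -v (h - p.1, p.2)) := by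
    ext p
    simp only [planeDensity]
    ring
  rw [← e3, e2] at h2
  simp only [sub_sub_cancel, neg_sq] at e1 h2
  rw [e1] at h2
  have cuy := H.cuy
  have h3 := rectInt_add h b (f := fun p => (1 + (-1 / h) * p.1) * uy p^2)
    (g := fun p => (1 + (-1 / h) * (h - p.1)) * uy p^2) (by fun_prop) (by fun_prop)
  have e4 : (fun p : ℝ × ℝ => uy p^2) = fun p => (1 + (-1 / h) * p.1) * uy p^2 +
      (1 + (-1 / h) * (h - p.1)) * uy p^2 := by
    ext p
    field_simp
    ring
  rw [e4, h3]
  linarith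

theorem shell_subset_radius {h L : ℝ} {q : ℝ × ℝ × ℝ} (hh : h ≤ 1) (hq : q ∈ shell h L) :
    1 / 2 ≤ q.1 ∧ q.1 ≤ 3 / 2 ∧ (q.1 - 1)^2 ≤ h^2 / 4 := by
  obtain ⟨⟨h1, h2⟩, -⟩ := hq
  exact ⟨by linarith, by linarith, by nlinarith⟩

theorem isCompact_shell (h L : ℝ) : IsCompact (shell h L) :=
  isCompact_Icc.prod (isCompact_Icc.prod isCompact_Icc)

theorem integrableOn_shell {h L : ℝ} {F : ℝ × ℝ × ℝ → ℝ} (hF : ContinuousOn F (shell h L)) :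
    IntegrableOn F (shell h L) :=
  hF.integrableOn_compact (isCompact_shell h L)

theorem setIntegral_shell {h L : ℝ} (hh : 0 ≤ h) (hL : 0 ≤ L) {F : ℝ × ℝ × ℝ → ℝ}
    (hF : Continuous F) :
    ∫ q in shell h L, F q =
      ∫ x in (0:ℝ)..h, ∫ θ in (0:ℝ)..(2 * π), ∫ z in (0:ℝ)..L, F (1 - h / 2 + x, θ, z) := by
  have h1 := intervalIntegral.integral_comp_add_left (a := 0) (b := h)
    (fun r => ∫ θ in (0:ℝ)..(2 * π), ∫ z in (0:ℝ)..L, F (r, θ, z)) (1 - h / 2)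
  rw [h1, shell, Measure.volume_eq_prod, setIntegral_prod _
    (integrableOn_shell (h := h) (L := L) hF.continuousOn),
    intervalIntegral.integral_of_le (by linarith), integral_Icc_eq_integral_Ioc,
    show 1 - h / 2 + 0 = 1 - h / 2 by ring, show 1 - h / 2 + h = 1 + h / 2 by ring]
  congr 1
  ext r
  rw [Measure.volume_eq_prod, setIntegral_prod (fun y => F (r, y))
    ((show Continuous fun y => F (r, y) by fun_prop).continuousOn.integrableOn_compact
      (isCompact_Icc.prod isCompact_Icc)),
    intervalIntegral.integral_of_le (by positivity), integral_Icc_eq_integral_Ioc]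
  congr 1
  ext θ
  rw [intervalIntegral.integral_of_le hL, integral_Icc_eq_integral_Ioc]

theorem setIntegral_shell_slice_theta {h L : ℝ} (hh : 0 ≤ h) (hL : 0 ≤ L)
    {F : ℝ × ℝ × ℝ → ℝ} (hF : Continuous F) :
    ∫ q in shell h L, F q =
      ∫ θ in (0:ℝ)..(2 * π), rectInt h L (fun p => F (1 - h / 2 + p.1, θ, p.2)) := by
  rw [setIntegral_shell hh hL hF]
  exact intervalIntegral_swap_of_continuous 0 h 0 (2 * π)
    (f := fun p => ∫ z in (0:ℝ)..L, F (1 - h / 2 + p.1, p.2, z)) (by fun_prop)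

theorem setIntegral_shell_slice_r {h L : ℝ} (hh : 0 ≤ h) (hL : 0 ≤ L)
    {F : ℝ × ℝ × ℝ → ℝ} (hF : Continuous F) :
    ∫ q in shell h L, F q =
      ∫ x in (0:ℝ)..h, rectInt L (2 * π) (fun p => F (1 - h / 2 + x, p.2, p.1)) := by
  rw [setIntegral_shell hh hL hF]
  congr 1
  ext x
  exact intervalIntegral_swap_of_continuous 0 (2 * π) 0 L
    (f := fun p => F (1 - h / 2 + x, p.1, p.2)) (by fun_prop)

theorem setIntegral_shell_slice_z {h L : ℝ} (hh : 0 ≤ h) (hL : 0 ≤ L)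
    {F : ℝ × ℝ × ℝ → ℝ} (hF : Continuous F) :
    ∫ q in shell h L, F q =
      ∫ z in (0:ℝ)..L, rectInt h (2 * π) (fun p => F (1 - h / 2 + p.1, p.2, z)) := by
  rw [setIntegral_shell_slice_r hh hL hF]
  exact intervalIntegral_swap_of_continuous 0 h 0 L
    (f := fun p => ∫ θ in (0:ℝ)..(2 * π), F (1 - h / 2 + p.1, θ, p.2)) (by fun_prop)

section Derivatives

variable {f : ℝ × ℝ × ℝ → ℝ}

theorem contDiff_fderiv_apply (hf : ContDiff ℝ (⊤ : ℕ∞) f) (v : ℝ × ℝ × ℝ) :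
    ContDiff ℝ (⊤ : ℕ∞) (fun q => fderiv ℝ f q v) :=
  (hf.fderiv_right (m := (⊤ : ℕ∞)) (by simp)).clm_apply contDiff_const

theorem contDiff_dr (hf : ContDiff ℝ (⊤ : ℕ∞) f) : ContDiff ℝ (⊤ : ℕ∞) (dr f) :=
  contDiff_fderiv_apply hf _

theorem contDiff_dth (hf : ContDiff ℝ (⊤ : ℕ∞) f) : ContDiff ℝ (⊤ : ℕ∞) (dth f) :=
  contDiff_fderiv_apply hf _

theorem contDiff_dz (hf : ContDiff ℝ (⊤ : ℕ∞) f) : ContDiff ℝ (⊤ : ℕ∞) (dz f) :=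
  contDiff_fderiv_apply hf _

theorem hasFDerivAt_of_smooth (hf : ContDiff ℝ (⊤ : ℕ∞) f) (q : ℝ × ℝ × ℝ) :
    HasFDerivAt f (fderiv ℝ f q) q :=
  (hf.differentiable (by simp) q).hasFDerivAt

theorem hasDerivAt_dr (hf : ContDiff ℝ (⊤ : ℕ∞) f) (r θ z : ℝ) :
    HasDerivAt (fun t => f (t, θ, z)) (dr f (r, θ, z)) r :=
  (hasFDerivAt_of_smooth hf (r, θ, z)).comp_hasDerivAt (f := fun t => (t, θ, z)) r
    ((hasDerivAt_id r).prodMk (hasDerivAt_const r (θ, z)))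

theorem hasDerivAt_dth (hf : ContDiff ℝ (⊤ : ℕ∞) f) (r θ z : ℝ) :
    HasDerivAt (fun t => f (r, t, z)) (dth f (r, θ, z)) θ :=
  (hasFDerivAt_of_smooth hf (r, θ, z)).comp_hasDerivAt (f := fun t => (r, t, z)) θ
    ((hasDerivAt_const θ r).prodMk ((hasDerivAt_id θ).prodMk (hasDerivAt_const θ z)))

theorem hasDerivAt_dz (hf : ContDiff ℝ (⊤ : ℕ∞) f) (r θ z : ℝ) :
    HasDerivAt (fun t => f (r, θ, t)) (dz f (r, θ, z)) z :=
  (hasFDerivAt_of_smooth hf (r, θ, z)).comp_hasDerivAt (f := fun t => (r, θ, t)) z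
    ((hasDerivAt_const z r).prodMk ((hasDerivAt_const z θ).prodMk (hasDerivAt_id z)))

theorem hasDerivAt_dr_shift (hf : ContDiff ℝ (⊤ : ℕ∞) f) (a x θ z : ℝ) :
    HasDerivAt (fun t => f (a + t, θ, z)) (dr f (a + x, θ, z)) x :=
  (hasDerivAt_dr hf (a + x) θ z).comp_const_add a x

theorem fderiv_fderiv_apply_comm (hf : ContDiff ℝ (⊤ : ℕ∞) f) (q v w : ℝ × ℝ × ℝ) :
    fderiv ℝ (fun p => fderiv ℝ f p v) q w = fderiv ℝ (fun p => fderiv ℝ f p w) q v := by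
  have hd : DifferentiableAt ℝ (fderiv ℝ f) q :=
    (hf.fderiv_right (m := (⊤ : ℕ∞)) (by simp)).differentiable (by simp) q
  have hs := hf.contDiffAt.isSymmSndFDerivAt (x := q)
    (by simpa using WithTop.coe_le_coe.2 (le_top : (2 : ℕ∞) ≤ ⊤))
  have key : ∀ v w, fderiv ℝ (fun p => fderiv ℝ f p v) q w = fderiv ℝ (fderiv ℝ f) q w v := by
    intro v w
    rw [fderiv_clm_apply hd (differentiableAt_const v)]
    simp
  rw [key, key, hs.eq]

theorem dr_dz_comm (hf : ContDiff ℝ (⊤ : ℕ∞) f) (q : ℝ × ℝ × ℝ) : dr (dz f) q = dz (dr f) q :=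
  fderiv_fderiv_apply_comm hf q _ _

theorem dr_dth_comm (hf : ContDiff ℝ (⊤ : ℕ∞) f) (q : ℝ × ℝ × ℝ) :
    dr (dth f) q = dth (dr f) q :=
  fderiv_fderiv_apply_comm hf q _ _

theorem dz_dth_comm (hf : ContDiff ℝ (⊤ : ℕ∞) f) (q : ℝ × ℝ × ℝ) :
    dz (dth f) q = dth (dz f) q :=
  fderiv_fderiv_apply_comm hf q _ _

theorem dr_eq_of_forall_eq {g : ℝ × ℝ × ℝ → ℝ} (hf : ContDiff ℝ (⊤ : ℕ∞) f)
    (hg : ContDiff ℝ (⊤ : ℕ∞) g) {θ z θ' z' : ℝ} (h : ∀ r, f (r, θ, z) = g (r, θ', z')) (r : ℝ) :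
    dr f (r, θ, z) = dr g (r, θ', z') :=
  ((hasDerivAt_dr hf r θ z).congr_of_eventuallyEq
    (Filter.Eventually.of_forall fun t => (h t).symm)).unique (hasDerivAt_dr hg r θ' z')

theorem dz_eq_of_forall_eq {g : ℝ × ℝ × ℝ → ℝ} (hf : ContDiff ℝ (⊤ : ℕ∞) f)
    (hg : ContDiff ℝ (⊤ : ℕ∞) g) {r θ r' θ' : ℝ} (h : ∀ z, f (r, θ, z) = g (r', θ', z)) (z : ℝ) :
    dz f (r, θ, z) = dz g (r', θ', z) :=
  ((hasDerivAt_dz hf r θ z).congr_of_eventuallyEq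
    (Filter.Eventually.of_forall fun t => (h t).symm)).unique (hasDerivAt_dz hg r' θ' z)

theorem Periodic3.eq_two_pi (hf : Periodic3 f) (r z : ℝ) : f (r, 2 * π, z) = f (r, 0, z) := by
  simpa using hf (r, 0, z)

end Derivatives

/-- Poincaré inequality in `z` for functions vanishing on `z = 0`. -/
theorem intervalIntegral_sq_le_of_zero {L : ℝ} (hL : 0 ≤ L) {v v' : ℝ → ℝ} (hv' : Continuous v')
    (hd : ∀ z, HasDerivAt v (v' z) z) (h0 : v 0 = 0) :
    ∫ z in (0:ℝ)..L, v z^2 ≤ 4 * L^2 * ∫ z in (0:ℝ)..L, v' z^2 := by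
  have hv : Continuous v := continuous_iff_continuousAt.2 fun z => (hd z).continuousAt
  have h1 : ∫ z in (0:ℝ)..L, (v z^2 + (z - L) * (2 * v z * v' z)) = 0 := by
    rw [intervalIntegral.integral_eq_sub_of_hasDerivAt (f := fun z => (z - L) * v z^2) _
      (Continuous.intervalIntegrable (by fun_prop) _ _)]
    · simp [h0]
    · intro z _
      exact (((hasDerivAt_id z).sub_const L).mul ((hd z).pow 2)).congr_deriv (by simp)
  have h2 : ∫ z in (0:ℝ)..L, ((1 / 2) * v z^2 - (2 * L^2) * v' z^2) ≤
      ∫ z in (0:ℝ)..L, (v z^2 + (z - L) * (2 * v z * v' z)) := by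
    refine intervalIntegral.integral_mono_on hL
      (Continuous.intervalIntegrable (by fun_prop) _ _)
      (Continuous.intervalIntegrable (by fun_prop) _ _) fun z hz => ?_
    have : (z - L)^2 * v' z^2 ≤ L^2 * v' z^2 := by
      have : (z - L)^2 ≤ L^2 := by nlinarith [hz.1, hz.2]
      gcongr
    nlinarith [sq_nonneg (v z + 2 * (z - L) * v' z)]
  rw [h1, intervalIntegral.integral_sub (Continuous.intervalIntegrable (by fun_prop) _ _)
    (Continuous.intervalIntegrable (by fun_prop) _ _), intervalIntegral.integral_const_mul,
    intervalIntegral.integral_const_mul] at h2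
  linarith

/-- The density `|e|² + l u² + |e|² / (l h²)` bounding all terms of the gradient, where optimizing
over `l` yields the interpolation inequality. -/
def shellDensity (l h : ℝ) (fr fθ fz : ℝ × ℝ × ℝ → ℝ) (q : ℝ × ℝ × ℝ) : ℝ :=
  eSq fr fθ fz q + l * fr q^2 + eSq fr fθ fz q / (l * h^2)

/-- Smooth displacement fields in `V_h¹ ∪ V_h²`. -/
structure IsAdmissible (L : ℝ) (fr fθ fz : ℝ × ℝ × ℝ → ℝ) : Prop where
  smooth_r : ContDiff ℝ (⊤ : ℕ∞) fr
  smooth_th : ContDiff ℝ (⊤ : ℕ∞) fθ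
  smooth_z : ContDiff ℝ (⊤ : ℕ∞) fz
  periodic_r : Periodic3 fr
  periodic_th : Periodic3 fθ
  periodic_z : Periodic3 fz
  bc : BC1 L fr fθ fz ∨ BC2 L fr fθ fz

section Estimates

variable {h L l : ℝ} {fr fθ fz : ℝ × ℝ × ℝ → ℝ}

theorem IsAdmissible.th_zero (A : IsAdmissible L fr fθ fz) (r θ : ℝ) :
    fθ (r, θ, 0) = 0 ∧ fθ (r, θ, L) = 0 := by
  rcases A.bc with H | H
  · exact ⟨(H r θ).2.1, (H r θ).2.2.2.2⟩
  · exact ⟨(H r θ).1, (H r θ).2.2.1⟩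

theorem continuousOn_eSq (hh1 : h ≤ 1) (A : IsAdmissible L fr fθ fz) :
    ContinuousOn (eSq fr fθ fz) (shell h L) := by
  have := A.smooth_r.continuous; have := A.smooth_th.continuous
  have := (contDiff_dr A.smooth_r).continuous; have := (contDiff_dth A.smooth_r).continuous
  have := (contDiff_dz A.smooth_r).continuous; have := (contDiff_dr A.smooth_th).continuous
  have := (contDiff_dth A.smooth_th).continuous; have := (contDiff_dz A.smooth_th).continuous
  have := (contDiff_dr A.smooth_z).continuous; have := (contDiff_dth A.smooth_z).continuous
  have := (contDiff_dz A.smooth_z).continuous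
  have hne : ∀ q ∈ shell h L, q.1 ≠ 0 := fun q hq =>
    (lt_of_lt_of_le (by norm_num) (shell_subset_radius hh1 hq).1).ne'
  unfold eSq
  fun_prop (disch := assumption)

theorem continuousOn_gradSq (hh1 : h ≤ 1) (A : IsAdmissible L fr fθ fz) :
    ContinuousOn (gradSq fr fθ fz) (shell h L) := by
  have := A.smooth_r.continuous; have := A.smooth_th.continuous
  have := (contDiff_dr A.smooth_r).continuous; have := (contDiff_dth A.smooth_r).continuous
  have := (contDiff_dz A.smooth_r).continuous; have := (contDiff_dr A.smooth_th).continuous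
  have := (contDiff_dth A.smooth_th).continuous; have := (contDiff_dz A.smooth_th).continuous
  have := (contDiff_dr A.smooth_z).continuous; have := (contDiff_dth A.smooth_z).continuous
  have := (contDiff_dz A.smooth_z).continuous
  have hne : ∀ q ∈ shell h L, q.1 ≠ 0 := fun q hq =>
    (lt_of_lt_of_le (by norm_num) (shell_subset_radius hh1 hq).1).ne'
  unfold gradSq
  fun_prop (disch := assumption)

theorem continuousOn_shellDensity (hh1 : h ≤ 1) (A : IsAdmissible L fr fθ fz) :
    ContinuousOn (shellDensity l h fr fθ fz) (shell h L) := by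
  have := A.smooth_r.continuous
  have := continuousOn_eSq hh1 A
  unfold shellDensity
  simp only [div_eq_mul_inv]
  fun_prop

theorem setIntegral_shell_mono {F G : ℝ × ℝ × ℝ → ℝ} (hF : ContinuousOn F (shell h L))
    (hG : ContinuousOn G (shell h L)) (hFG : ∀ q ∈ shell h L, F q ≤ G q) :
    ∫ q in shell h L, F q ≤ ∫ q in shell h L, G q :=
  setIntegral_mono_on (integrableOn_shell hF) (integrableOn_shell hG)
    (isCompact_shell h L).measurableSet hFG

/-- Pointwise bounds of the strain components by the strain density. -/
theorem strain_bounds {q : ℝ × ℝ × ℝ} (hr0 : 1 / 2 ≤ q.1) (hr1 : q.1 ≤ 3 / 2) :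
    dr fr q^2 ≤ eSq fr fθ fz q ∧ (dth fθ q + fr q)^2 ≤ 9 / 4 * eSq fr fθ fz q ∧
    dz fz q^2 ≤ eSq fr fθ fz q ∧
    (dr fθ q + (dth fr q - fθ q) / q.1)^2 ≤ 2 * eSq fr fθ fz q ∧
    (dz fr q + dr fz q)^2 ≤ 2 * eSq fr fθ fz q ∧
    (q.1 * dz fθ q + dth fz q)^2 ≤ 9 / 2 * eSq fr fθ fz q ∧
    dr fr q^2 + dz fz q^2 ≤ eSq fr fθ fz q ∧
    dr fr q^2 + (dth fθ q + fr q)^2 ≤ 9 / 4 * eSq fr fθ fz q ∧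
    dr fr q^2 + ((dth fθ q + fr q) / q.1)^2 + dz fz q^2 ≤ eSq fr fθ fz q := by
  have hr : 0 < q.1 := by linarith
  have hr2 : q.1^2 ≤ 9 / 4 := by nlinarith
  have e1 : (dth fθ q + fr q)^2 = q.1^2 * ((dth fθ q + fr q) / q.1)^2 := by
    field_simp
  have e2 : (q.1 * dz fθ q + dth fz q)^2 = q.1^2 * (dz fθ q + dth fz q / q.1)^2 := by
    field_simp
  have b1 : (dth fθ q + fr q)^2 ≤ 9 / 4 * ((dth fθ q + fr q) / q.1)^2 := by
    rw [e1]; gcongr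
  have b2 : (q.1 * dz fθ q + dth fz q)^2 ≤ 9 / 4 * (dz fθ q + dth fz q / q.1)^2 := by
    rw [e2]; gcongr
  have s1 := sq_nonneg (dr fr q)
  have s2 := sq_nonneg ((dth fθ q + fr q) / q.1)
  have s3 := sq_nonneg (dz fz q)
  have s4 := sq_nonneg (dr fθ q + (dth fr q - fθ q) / q.1)
  have s5 := sq_nonneg (dz fr q + dr fz q)
  have s6 := sq_nonneg (dz fθ q + dth fz q / q.1)
  unfold eSq
  have e3 : ∀ x : ℝ, 2 * (x / 2)^2 = x^2 / 2 := fun x => by ring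
  rw [e3, e3, e3]
  refine ⟨?_, ?_, ?_, ?_, ?_, ?_, ?_, ?_, ?_⟩ <;> linarith

theorem eSq_nonneg (fr fθ fz : ℝ × ℝ × ℝ → ℝ) (q : ℝ × ℝ × ℝ) : 0 ≤ eSq fr fθ fz q := by
  unfold eSq
  positivity

/-- Estimate of `∂_z φ_r` from the slices `θ = const`. -/
theorem IsAdmissible.dz_r_bound (A : IsAdmissible L fr fθ fz) (hL : 0 < L) (hh : 0 < h)
    (hh1 : h ≤ 1) (hl : 0 < l) :
    ∫ q in shell h L, dz fr q^2 ≤ 2400 * ∫ q in shell h L, shellDensity l h fr fθ fz q := by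
  have c0 := A.smooth_r.continuous
  have c1 := (contDiff_dr A.smooth_r).continuous
  have c2 := (contDiff_dz A.smooth_r).continuous
  have c3 := (contDiff_dz A.smooth_z).continuous
  have c4 := (contDiff_dr A.smooth_z).continuous
  have c5 := (contDiff_dr (contDiff_dz A.smooth_z)).continuous
  have c6 := (contDiff_dz (contDiff_dr A.smooth_z)).continuous
  have cP : Continuous fun q => (dz fr q + dr fz q)^2 + dr fr q^2 + dz fz q^2 + l * fr q^2 +
      (dr fr q^2 + dz fz q^2) / (l * h^2) := by
    simp only [div_eq_mul_inv]
    fun_prop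
  have pair : ∀ θ, PlanePair L 0
      (fun p => fr (1 - h / 2 + p.1, θ, p.2)) (fun p => dr fr (1 - h / 2 + p.1, θ, p.2))
      (fun p => dz fr (1 - h / 2 + p.1, θ, p.2)) (fun p => dz fz (1 - h / 2 + p.1, θ, p.2))
      (fun p => dr (dz fz) (1 - h / 2 + p.1, θ, p.2)) (fun p => dr fz (1 - h / 2 + p.1, θ, p.2))
      (fun p => dz (dr fz) (1 - h / 2 + p.1, θ, p.2)) := by
    intro θ
    refine ⟨by fun_prop, by fun_prop, by fun_prop, by fun_prop, by fun_prop, by fun_prop,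
      by fun_prop, fun x y => hasDerivAt_dr_shift A.smooth_r _ x θ y,
      fun x y => hasDerivAt_dz A.smooth_r (1 - h / 2 + x) θ y,
      fun x y => hasDerivAt_dr_shift (contDiff_dz A.smooth_z) _ x θ y,
      fun x y => hasDerivAt_dz (contDiff_dr A.smooth_z) (1 - h / 2 + x) θ y,
      fun p => ?_, fun x x' => ?_⟩
    · simp only [dr_dz_comm A.smooth_z, sub_self, zero_mul]
    · rcases A.bc with H | H
      · simp only [(H _ θ).1, (H _ θ).2.2.2.1, zero_mul]
      · have e := dr_eq_of_forall_eq A.smooth_z A.smooth_z (θ := θ) (z := L) (θ' := θ) (z' := 0)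
          fun r => by rw [(H r θ).2.1, (H r θ).2.2.2]
        have e0 : ∀ r, dr fz (r, θ, 0) = 0 := fun r =>
          ((hasDerivAt_dr A.smooth_z r θ 0).congr_of_eventuallyEq
            (Filter.Eventually.of_forall fun t => ((H t θ).2.1).symm)).unique
              (hasDerivAt_const r (0:ℝ))
        simp only [e, e0, mul_zero]
  have h1 : ∫ q in shell h L, dz fr q^2 ≤ 800 * ∫ q in shell h L,
      ((dz fr q + dr fz q)^2 + dr fr q^2 + dz fz q^2 + l * fr q^2 +
        (dr fr q^2 + dz fz q^2) / (l * h^2)) := by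
    rw [setIntegral_shell_slice_theta hh.le hL.le (by fun_prop),
      setIntegral_shell_slice_theta hh.le hL.le cP, ← intervalIntegral.integral_const_mul]
    refine intervalIntegral.integral_mono_on (by positivity)
      (Continuous.intervalIntegrable (by unfold rectInt; fun_prop) _ _)
      (Continuous.intervalIntegrable (by unfold rectInt; fun_prop) _ _) fun θ _ => ?_
    exact (pair θ).bound hL.le hh hh1 hl (by simp)
  have h2 : ∫ q in shell h L,
      ((dz fr q + dr fz q)^2 + dr fr q^2 + dz fz q^2 + l * fr q^2 +
        (dr fr q^2 + dz fz q^2) / (l * h^2)) ≤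
      ∫ q in shell h L, 3 * shellDensity l h fr fθ fz q := by
    refine setIntegral_shell_mono cP.continuousOn
      (continuousOn_const.mul (continuousOn_shellDensity hh1 A)) fun q hq => ?_
    obtain ⟨hr0, hr1, -⟩ := shell_subset_radius hh1 hq
    obtain ⟨-, -, -, -, b5, -, b7, -⟩ := strain_bounds (fr := fr) (fθ := fθ) (fz := fz) hr0 hr1
    have b7' := div_le_div_of_nonneg_right b7 (show 0 ≤ l * h^2 by positivity)
    have e0 := eSq_nonneg fr fθ fz q
    have e1 : 0 ≤ l * fr q^2 := by positivity
    have e2 : 0 ≤ eSq fr fθ fz q / (l * h^2) := by positivity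
    unfold shellDensity
    linarith
  rw [integral_const_mul] at h2
  linarith

/-- Estimate of `∂_z φ_θ` and `∂_θ φ_z` from the slices `r = const`. -/
theorem IsAdmissible.dz_th_bound (A : IsAdmissible L fr fθ fz) (hL : 0 < L) (hh : 0 < h)
    (hh1 : h ≤ 1) (hl : 0 < l) :
    ∫ q in shell h L, (dz fθ q^2 + dth fz q^2) ≤
      40 * ∫ q in shell h L, shellDensity l h fr fθ fz q := by
  have c0 := A.smooth_th.continuous
  have c1 := (contDiff_dz A.smooth_th).continuous
  have c2 := (contDiff_dth A.smooth_th).continuous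
  have c3 := (contDiff_dz A.smooth_z).continuous
  have c4 := (contDiff_dth A.smooth_z).continuous
  have c5 := (contDiff_dth (contDiff_dz A.smooth_z)).continuous
  have c6 := (contDiff_dz (contDiff_dth A.smooth_z)).continuous
  have h0 : ∀ r, rectInt L (2 * π) (fun p => dz fθ (r, p.2, p.1) * dth fz (r, p.2, p.1) -
      dth fθ (r, p.2, p.1) * dz fz (r, p.2, p.1)) = 0 := by
    intro r
    have := rectInt_divergence L (2 * π) 0 1
      (U := fun p => fθ (r, p.2, p.1)) (Ux := fun p => dz fθ (r, p.2, p.1))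
      (Uy := fun p => dth fθ (r, p.2, p.1)) (G := fun p => dth fz (r, p.2, p.1))
      (Gx := fun p => dz (dth fz) (r, p.2, p.1)) (V := fun p => dz fz (r, p.2, p.1))
      (Vy := fun p => dth (dz fz) (r, p.2, p.1))
      (by fun_prop) (by fun_prop) (by fun_prop) (by fun_prop) (by fun_prop) (by fun_prop)
      (by fun_prop) (fun x y => hasDerivAt_dz A.smooth_th r y x)
      (fun x y => hasDerivAt_dth A.smooth_th r y x)
      (fun x y => hasDerivAt_dz (contDiff_dth A.smooth_z) r y x)
      (fun x y => hasDerivAt_dth (contDiff_dz A.smooth_z) r y x)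
      (fun x => by
        rw [A.periodic_th.eq_two_pi, dz_eq_of_forall_eq A.smooth_z A.smooth_z
          (fun z => A.periodic_z.eq_two_pi r z)])
    simpa [A.th_zero, dz_dth_comm A.smooth_z] using this
  have h1 : ∫ q in shell h L, 8 * q.1 * (dz fθ q * dth fz q - dth fθ q * dz fz q) = 0 := by
    rw [setIntegral_shell_slice_r hh.le hL.le (by fun_prop)]
    simp only [rectInt_const_mul, h0]
    simp
  have cF : Continuous fun q => dz fθ q^2 + dth fz q^2 := by fun_prop
  have cJ : Continuous fun q : ℝ × ℝ × ℝ =>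
    8 * q.1 * (dz fθ q * dth fz q - dth fθ q * dz fz q) := by fun_prop
  have h2 : ∫ q in shell h L, ((dz fθ q^2 + dth fz q^2) +
      8 * q.1 * (dz fθ q * dth fz q - dth fθ q * dz fz q)) ≤
      ∫ q in shell h L, 40 * shellDensity l h fr fθ fz q := by
    refine setIntegral_shell_mono (cF.add cJ).continuousOn
      (continuousOn_const.mul (continuousOn_shellDensity hh1 A)) fun q hq => ?_
    obtain ⟨hr0, hr1, -⟩ := shell_subset_radius hh1 hq
    obtain ⟨-, b2, b3, -, -, b6, -⟩ := strain_bounds (fr := fr) (fθ := fθ) (fz := fz) hr0 hr1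
    have b3' := div_le_div_of_nonneg_right b3 (show 0 ≤ l * h^2 by positivity)
    have e0 := eSq_nonneg fr fθ fz q
    have e1 : 0 ≤ l * fr q^2 := by positivity
    have e2 : 0 ≤ eSq fr fθ fz q / (l * h^2) := by positivity
    have k1 := abs_mul_le_half (dth fθ q + fr q) (dz fz q)
    have k2 := mul_mul_le hl hh hh1 (κ := 1) (by simp) (fr q) (dz fz q)
    rw [one_mul] at k2
    have k3 : |dth fθ q * dz fz q| ≤ |(dth fθ q + fr q) * dz fz q| + |fr q * dz fz q| := by
      rw [show dth fθ q * dz fz q = (dth fθ q + fr q) * dz fz q - fr q * dz fz q by ring]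
      exact abs_sub _ _
    have k4 : -(q.1 * (dth fθ q * dz fz q)) ≤ 3 / 2 * |dth fθ q * dz fz q| := by
      calc -(q.1 * (dth fθ q * dz fz q)) ≤ |q.1 * (dth fθ q * dz fz q)| := neg_le_abs _
        _ = q.1 * |dth fθ q * dz fz q| := by rw [abs_mul, abs_of_nonneg (by linarith)]
        _ ≤ _ := by gcongr
    have k5 : dz fθ q^2 ≤ 4 * (q.1^2 * dz fθ q^2) := by
      have : 1 / 4 ≤ q.1^2 := by nlinarith
      nlinarith [sq_nonneg (dz fθ q)]
    unfold shellDensity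
    linarith [sq_nonneg (dth fz q), add_sq (q.1 * dz fθ q) (dth fz q),
      mul_pow q.1 (dz fθ q) 2]
  rw [integral_add (integrableOn_shell cF.continuousOn) (integrableOn_shell cJ.continuousOn), h1,
    integral_const_mul] at h2
  linarith

/-- Poincaré inequality for `φ_θ`. -/
theorem IsAdmissible.th_bound (A : IsAdmissible L fr fθ fz) (hL : 0 < L) (hh : 0 < h)
    (hh1 : h ≤ 1) (hl : 0 < l) :
    ∫ q in shell h L, fθ q^2 ≤
      160 * L^2 * ∫ q in shell h L, shellDensity l h fr fθ fz q := by
  have c0 := A.smooth_th.continuous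
  have c1 := (contDiff_dz A.smooth_th).continuous
  have c4 := (contDiff_dth A.smooth_z).continuous
  have h1 := A.dz_th_bound hL hh hh1 hl
  have h2 : ∫ q in shell h L, dz fθ q^2 ≤ ∫ q in shell h L, (dz fθ q^2 + dth fz q^2) :=
    setIntegral_shell_mono (by fun_prop) (by fun_prop) fun q _ => by
      linarith [sq_nonneg (dth fz q)]
  have h3 : ∫ q in shell h L, fθ q^2 ≤ 4 * L^2 * ∫ q in shell h L, dz fθ q^2 := by
    rw [setIntegral_shell hh.le hL.le (by fun_prop), setIntegral_shell hh.le hL.le (by fun_prop),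
      ← intervalIntegral.integral_const_mul]
    simp only [← intervalIntegral.integral_const_mul]
    refine intervalIntegral.integral_mono_on hh.le
      (Continuous.intervalIntegrable (by fun_prop) _ _)
      (Continuous.intervalIntegrable (by fun_prop) _ _) fun x _ => ?_
    refine intervalIntegral.integral_mono_on (by positivity)
      (Continuous.intervalIntegrable (by fun_prop) _ _)
      (Continuous.intervalIntegrable (by fun_prop) _ _) fun θ _ => ?_
    rw [intervalIntegral.integral_const_mul]
    exact intervalIntegral_sq_le_of_zero hL.le (by fun_prop)
      (fun z => hasDerivAt_dz A.smooth_th _ θ z) (A.th_zero _ θ).1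
  have h4 : 4 * L^2 * ∫ q in shell h L, dz fθ q^2 ≤
      4 * L^2 * (40 * ∫ q in shell h L, shellDensity l h fr fθ fz q) := by
    gcongr
    exact h2.trans h1
  linarith

/-- Estimate of `∂_θ φ_r` from the slices `z = const`. -/
theorem IsAdmissible.dth_r_bound (A : IsAdmissible L fr fθ fz) (hL : 0 < L) (hh : 0 < h)
    (hh1 : h ≤ 1 / 100) (hl : 0 < l) :
    ∫ q in shell h L, dth fr q^2 ≤ 16000 * (∫ q in shell h L, shellDensity l h fr fθ fz q) +
      20000 * ∫ q in shell h L, fθ q^2 := by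
  have c0 := A.smooth_r.continuous
  have c1 := (contDiff_dr A.smooth_r).continuous
  have c2 := (contDiff_dth A.smooth_r).continuous
  have c3 := (contDiff_dth A.smooth_th).continuous
  have c4 := (contDiff_dr A.smooth_th).continuous
  have c5 := (contDiff_dr (contDiff_dth A.smooth_th)).continuous
  have c6 := (contDiff_dth (contDiff_dr A.smooth_th)).continuous
  have c7 := A.smooth_th.continuous
  have cP : Continuous fun q => (dth fr q + dr fθ q)^2 + dr fr q^2 + (dth fθ q + fr q)^2 +
      l * fr q^2 + (dr fr q^2 + (dth fθ q + fr q)^2) / (l * h^2) := by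
    simp only [div_eq_mul_inv]
    fun_prop
  have pair : ∀ z, PlanePair (2 * π) 1
      (fun p => fr (1 - h / 2 + p.1, p.2, z)) (fun p => dr fr (1 - h / 2 + p.1, p.2, z))
      (fun p => dth fr (1 - h / 2 + p.1, p.2, z))
      (fun p => dth fθ (1 - h / 2 + p.1, p.2, z) + fr (1 - h / 2 + p.1, p.2, z))
      (fun p => dr (dth fθ) (1 - h / 2 + p.1, p.2, z) + dr fr (1 - h / 2 + p.1, p.2, z))
      (fun p => dr fθ (1 - h / 2 + p.1, p.2, z))
      (fun p => dth (dr fθ) (1 - h / 2 + p.1, p.2, z)) := by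
    intro z
    refine ⟨by fun_prop, by fun_prop, by fun_prop, by fun_prop, by fun_prop, by fun_prop,
      by fun_prop, fun x y => hasDerivAt_dr_shift A.smooth_r _ x y z,
      fun x y => hasDerivAt_dth A.smooth_r (1 - h / 2 + x) y z,
      fun x y => (hasDerivAt_dr_shift (contDiff_dth A.smooth_th) _ x y z).fun_add
        (hasDerivAt_dr_shift A.smooth_r _ x y z),
      fun x y => hasDerivAt_dth (contDiff_dr A.smooth_th) (1 - h / 2 + x) y z,
      fun p => ?_, fun x x' => ?_⟩
    · simp only [dr_dth_comm A.smooth_th]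
      ring
    · simp only [A.periodic_r.eq_two_pi, dr_eq_of_forall_eq A.smooth_th A.smooth_th
        (fun r => A.periodic_th.eq_two_pi r z)]
  have h1 : ∫ q in shell h L, dth fr q^2 ≤ 800 * ∫ q in shell h L,
      ((dth fr q + dr fθ q)^2 + dr fr q^2 + (dth fθ q + fr q)^2 +
      l * fr q^2 + (dr fr q^2 + (dth fθ q + fr q)^2) / (l * h^2)) := by
    rw [setIntegral_shell_slice_z hh.le hL.le (by fun_prop),
      setIntegral_shell_slice_z hh.le hL.le cP, ← intervalIntegral.integral_const_mul]
    refine intervalIntegral.integral_mono_on hL.le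
      (Continuous.intervalIntegrable (by unfold rectInt; fun_prop) _ _)
      (Continuous.intervalIntegrable (by unfold rectInt; fun_prop) _ _) fun z _ => ?_
    exact (pair z).bound (by positivity) hh (by linarith) hl (by simp)
  have cD := continuousOn_shellDensity (l := l) (h := h) (by linarith) A
  have h2 : ∫ q in shell h L,
      ((dth fr q + dr fθ q)^2 + dr fr q^2 + (dth fθ q + fr q)^2 +
      l * fr q^2 + (dr fr q^2 + (dth fθ q + fr q)^2) / (l * h^2)) ≤
      ∫ q in shell h L, (10 * shellDensity l h fr fθ fz q + (12 * fθ q^2 +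
        3 / 10000 * dth fr q^2)) := by
    refine setIntegral_shell_mono cP.continuousOn (by fun_prop) fun q hq => ?_
    obtain ⟨hr0, hr1, hr2⟩ := shell_subset_radius (by linarith) hq
    obtain ⟨b1, b2, -, b4, -, -, -, b8, -⟩ :=
      strain_bounds (fr := fr) (fθ := fθ) (fz := fz) hr0 hr1
    have b8' := div_le_div_of_nonneg_right b8 (show 0 ≤ l * h^2 by positivity)
    have e0 := eSq_nonneg fr fθ fz q
    have e1 : 0 ≤ l * fr q^2 := by positivity
    have e2 : 0 ≤ eSq fr fθ fz q / (l * h^2) := by positivity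
    have hr : 0 < q.1 := by linarith
    have k1 : (fθ q / q.1)^2 ≤ 4 * fθ q^2 := by
      rw [div_pow, div_le_iff₀ (by positivity)]
      have : 1 ≤ 4 * q.1^2 := by nlinarith
      nlinarith [sq_nonneg (fθ q)]
    have k2 : (dth fr q * (1 - 1 / q.1))^2 ≤ 1 / 10000 * dth fr q^2 := by
      have k3 : (1 - 1 / q.1)^2 = (q.1 - 1)^2 / q.1^2 := by field_simp
      have k4 : (1 - 1 / q.1)^2 ≤ 1 / 10000 := by
        rw [k3, div_le_iff₀ (by positivity)]
        nlinarith
      rw [mul_pow, mul_comm]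
      gcongr
    have k5 : dth fr q + dr fθ q = (dr fθ q + (dth fr q - fθ q) / q.1) + fθ q / q.1 +
        dth fr q * (1 - 1 / q.1) := by
      field_simp
      ring
    have k6 : ∀ a b c : ℝ, (a + b + c)^2 ≤ 3 * (a^2 + b^2 + c^2) := fun a b c => by
      nlinarith [sq_nonneg (a - b), sq_nonneg (b - c), sq_nonneg (a - c)]
    have k7 := k6 (dr fθ q + (dth fr q - fθ q) / q.1) (fθ q / q.1) (dth fr q * (1 - 1 / q.1))
    rw [← k5] at k7
    rw [mul_div_assoc] at b8'
    unfold shellDensity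
    linarith
  have hR : ∫ q in shell h L, (10 * shellDensity l h fr fθ fz q + (12 * fθ q^2 +
      3 / 10000 * dth fr q^2)) = 10 * (∫ q in shell h L, shellDensity l h fr fθ fz q) +
      (12 * (∫ q in shell h L, fθ q^2) + 3 / 10000 * ∫ q in shell h L, dth fr q^2) := by
    rw [integral_add (integrableOn_shell (by fun_prop)) (integrableOn_shell (by fun_prop)),
      integral_add (integrableOn_shell (by fun_prop)) (integrableOn_shell (by fun_prop)),
      integral_const_mul, integral_const_mul, integral_const_mul]
  rw [hR] at h2
  have h3 : 0 ≤ ∫ q in shell h L, fθ q^2 := integral_nonneg fun q => sq_nonneg _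
  have h4 : 0 ≤ ∫ q in shell h L, shellDensity l h fr fθ fz q := integral_nonneg fun q => by
    have := eSq_nonneg fr fθ fz q
    unfold shellDensity
    positivity
  linarith

end Estimates

section Estimates

variable {h L l : ℝ} {fr fθ fz : ℝ × ℝ × ℝ → ℝ}

theorem gradSq_le {q : ℝ × ℝ × ℝ} (hr0 : 1 / 2 ≤ q.1) (hr1 : q.1 ≤ 3 / 2) :
    gradSq fr fθ fz q ≤ 12 * eSq fr fθ fz q + (24 * (dth fr q^2 + fθ q^2) + (3 * dz fr q^2 +
      4 * (dz fθ q^2 + dth fz q^2))) := by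
  obtain ⟨-, -, -, b4, b5, -, -, -, b9⟩ := strain_bounds (fr := fr) (fθ := fθ) (fz := fz) hr0 hr1
  have hr : 0 < q.1 := by linarith
  have hr2 : 1 ≤ 4 * q.1^2 := by nlinarith
  have e0 := eSq_nonneg fr fθ fz q
  have div_bound : ∀ x : ℝ, (x / q.1)^2 ≤ 4 * x^2 := fun x => by
    rw [div_pow, div_le_iff₀ (by positivity)]
    nlinarith [sq_nonneg x]
  have k1 := div_bound (dth fr q - fθ q)
  have k2 := div_bound (dth fz q)
  have sub_bound : ∀ x y : ℝ, (x - y)^2 ≤ 2 * x^2 + 2 * y^2 := fun x y => by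
    nlinarith [sq_nonneg (x + y)]
  have k3 := sub_bound (dth fr q) (fθ q)
  have k4 := sub_bound (dr fθ q + (dth fr q - fθ q) / q.1) ((dth fr q - fθ q) / q.1)
  have k5 := sub_bound (dz fr q + dr fz q) (dz fr q)
  rw [add_sub_cancel_right] at k4
  rw [add_sub_cancel_left] at k5
  unfold gradSq
  linarith [sq_nonneg (dz fθ q)]

/-- Bound of the gradient by the parameter-dependent density. -/
theorem IsAdmissible.gradSq_bound (A : IsAdmissible L fr fθ fz) (hL : 0 < L) (hh : 0 < h)
    (hh1 : h ≤ 1 / 100) (hl : 0 < l) :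
    ∫ q in shell h L, gradSq fr fθ fz q ≤ (400000 + 80000000 * L^2) *
      ∫ q in shell h L, shellDensity l h fr fθ fz q := by
  have c0 := A.smooth_th.continuous
  have c1 := (contDiff_dth A.smooth_r).continuous
  have c2 := (contDiff_dz A.smooth_r).continuous
  have c3 := (contDiff_dz A.smooth_th).continuous
  have c4 := (contDiff_dth A.smooth_z).continuous
  have c5 := A.smooth_r.continuous
  have cE := continuousOn_eSq (by linarith) A (h := h)
  have cG := continuousOn_gradSq (by linarith) A (h := h)
  have cD := continuousOn_shellDensity (l := l) (h := h) (by linarith) A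
  have h1 := A.dz_r_bound hL hh (by linarith) hl
  have h2 := A.dz_th_bound hL hh (by linarith) hl
  have h3 := A.th_bound hL hh (by linarith) hl
  have h4 := A.dth_r_bound hL hh hh1 hl
  have h5 : ∫ q in shell h L, eSq fr fθ fz q ≤ ∫ q in shell h L, shellDensity l h fr fθ fz q :=
    setIntegral_shell_mono cE cD fun q _ => by
      have := eSq_nonneg fr fθ fz q
      have e1 : 0 ≤ l * fr q^2 := by positivity
      have e2 : 0 ≤ eSq fr fθ fz q / (l * h^2) := by positivity
      unfold shellDensity
      linarith
  have h6 := setIntegral_shell_mono cG (G := fun q => 12 * eSq fr fθ fz q +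
      (24 * (dth fr q^2 + fθ q^2) + (3 * dz fr q^2 + 4 * (dz fθ q^2 + dth fz q^2))))
      (by fun_prop) fun q hq => by
    obtain ⟨hr0, hr1, -⟩ := shell_subset_radius (by linarith) hq
    exact gradSq_le hr0 hr1
  rw [integral_add (integrableOn_shell (by fun_prop)) (integrableOn_shell (by fun_prop)),
    integral_add (integrableOn_shell (by fun_prop)) (integrableOn_shell (by fun_prop)),
    integral_add (integrableOn_shell (by fun_prop)) (integrableOn_shell (by fun_prop)),
    integral_const_mul, integral_const_mul, integral_const_mul, integral_const_mul,
    integral_add (integrableOn_shell (by fun_prop)) (integrableOn_shell (by fun_prop))] at h6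
  have h7 : 0 ≤ ∫ q in shell h L, shellDensity l h fr fθ fz q := integral_nonneg fun q => by
    have := eSq_nonneg fr fθ fz q
    unfold shellDensity
    positivity
  have h8 : 0 ≤ L^2 * ∫ q in shell h L, shellDensity l h fr fθ fz q := by positivity
  linarith

theorem IsAdmissible.integral_shellDensity (A : IsAdmissible L fr fθ fz) (hh1 : h ≤ 1) :
    ∫ q in shell h L, shellDensity l h fr fθ fz q = (∫ q in shell h L, eSq fr fθ fz q) +
      l * (∫ q in shell h L, fr q^2) + (∫ q in shell h L, eSq fr fθ fz q) / (l * h^2) := by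
  have c := A.smooth_r.continuous
  have cE := continuousOn_eSq hh1 A
  unfold shellDensity
  simp only [div_eq_mul_inv]
  rw [integral_add (integrableOn_shell (by fun_prop)) (integrableOn_shell (by fun_prop)),
    integral_add (integrableOn_shell (by fun_prop)) (integrableOn_shell (by fun_prop)),
    integral_const_mul, integral_mul_const]

end Estimates

/-- Optimization of the free parameter. -/
theorem le_of_forall_parameter {X K E U h : ℝ} (hh : 0 < h) (hK : 0 ≤ K) (hE : 0 ≤ E)
    (hU : 0 ≤ U) (H : ∀ l > 0, X ≤ K * (E + l * U + E / (l * h^2))) :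
    X ≤ 2 * K * √E * (√U / h + √E) := by
  have hε : ∀ ε > 0, X ≤ K * (E + 2 * (√E + ε) * (√U + ε) / h) := by
    intro ε hε
    have hE' := sqrt_nonneg E
    have hU' := sqrt_nonneg U
    refine (H ((√E + ε) / (h * (√U + ε))) (by positivity)).trans ?_
    have e1 : (√E + ε) / (h * (√U + ε)) * (√U + ε)^2 = (√E + ε) * (√U + ε) / h := by
      field_simp
    have e2 : (√E + ε)^2 / ((√E + ε) / (h * (√U + ε)) * h^2) = (√E + ε) * (√U + ε) / h := by
      field_simp
    have e3 : U ≤ (√U + ε)^2 := by nlinarith [sq_sqrt hU]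
    have e4 : E ≤ (√E + ε)^2 := by nlinarith [sq_sqrt hE]
    have e5 : (√E + ε) / (h * (√U + ε)) * U ≤ (√E + ε) / (h * (√U + ε)) * (√U + ε)^2 := by gcongr
    have e6 : E / ((√E + ε) / (h * (√U + ε)) * h^2) ≤
        (√E + ε)^2 / ((√E + ε) / (h * (√U + ε)) * h^2) := by gcongr
    refine mul_le_mul_of_nonneg_left ?_ hK
    rw [e1] at e5
    rw [e2] at e6
    rw [mul_assoc 2, mul_div_assoc]
    linarith
  have hlim : Filter.Tendsto (fun ε : ℝ => K * (E + 2 * (√E + ε) * (√U + ε) / h))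
      (nhdsWithin 0 (Set.Ioi 0)) (nhds (K * (E + 2 * (√E + 0) * (√U + 0) / h))) :=
    (Continuous.tendsto (by fun_prop) 0).mono_left nhdsWithin_le_nhds
  have hX := ge_of_tendsto hlim (Filter.eventually_of_mem self_mem_nhdsWithin hε)
  have e : 2 * K * √E * (√U / h + √E) - K * (E + 2 * (√E + 0) * (√U + 0) / h) = K * E := by
    have := mul_self_sqrt hE
    linear_combination 2 * K * this
  have : 0 ≤ K * E := by positivity
  linarith

/-- Korn–Sobolev-type interpolation inequality for the shell (Corollary 3.1):
‖∇φ‖² ≤ C(L)‖e(φ)‖(‖φ_r‖/h + ‖e(φ)‖) for φ ∈ V_h¹ ∪ V_h². -/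
theorem korn_sobolev_interpolation :
    ∀ L : ℝ, 0 < L → ∃ C h₀ : ℝ, 0 < C ∧ 0 < h₀ ∧
      ∀ h : ℝ, 0 < h → h < h₀ →
        ∀ fr fθ fz : ℝ × ℝ × ℝ → ℝ,
          ContDiff ℝ (⊤ : ℕ∞) fr → ContDiff ℝ (⊤ : ℕ∞) fθ → ContDiff ℝ (⊤ : ℕ∞) fz →
          Periodic3 fr → Periodic3 fθ → Periodic3 fz →
          (BC1 L fr fθ fz ∨ BC2 L fr fθ fz) →
          (∫ q in shell h L, gradSq fr fθ fz q)
            ≤ C * Real.sqrt (∫ q in shell h L, eSq fr fθ fz q) *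
                (Real.sqrt (∫ q in shell h L, (fr q)^2) / h
                  + Real.sqrt (∫ q in shell h L, eSq fr fθ fz q)) := by
  intro L hL
  refine ⟨2 * (400000 + 80000000 * L^2), 1 / 100, by positivity, by norm_num, ?_⟩
  intro h hh hh1 fr fθ fz sr sθ sz pr pθ pz bc
  have A : IsAdmissible L fr fθ fz := ⟨sr, sθ, sz, pr, pθ, pz, bc⟩
  refine le_of_forall_parameter hh (by positivity)
    (integral_nonneg fun q => eSq_nonneg fr fθ fz q) (integral_nonneg fun q => sq_nonneg (fr q))
    fun l hl => ?_
  rw [← A.integral_shellDensity (by linarith)]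
  exact A.gradSq_bound hL hh hh1.le hl
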